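/- arXiv:2504.14623 — 3 statements merged into one kernel-verified Lean document; each statement's English description precedes it below -/
import Mathlib

section
/- Let k ≥ 1 and let t be a k-fair trace. Then for every pair of processes p, p' ∈ P, the lengths of their views differ by at most k − 1: | |view_p(t)| − |view_{p'}(t)| | ≤ k − 1. -/
variable {α P : Type*}

/-- One swap of two adjacent independent letters. -/
def SwapAdj [DecidableEq P] (loc : α → Finset P) (w w' : List α) : Prop :=
  ∃ (u v : List α) (a b : α), loc a ∩ loc b = ∅ ∧
    w = u ++ a :: b :: v ∧ w' = u ++ b :: a :: v

/-- Trace equivalence: finitely many swaps of adjacent independent letters. -/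
def TraceEquiv [DecidableEq P] (loc : α → Finset P) : List α → List α → Prop :=
  Relation.ReflTransGen (SwapAdj loc)

/-- The set of processes participating in a word. -/
def locWord [DecidableEq P] (loc : α → Finset P) (w : List α) : Finset P :=
  w.foldr (fun a s => loc a ∪ s) ∅

/-- The trace of `w` is `k`-fair: every factor of length at least `k` of every
linearisation involves all processes. -/
def IsFairTrace [DecidableEq P] [Fintype P] (loc : α → Finset P) (k : ℕ)
    (w : List α) : Prop :=
  ∀ w' u v x, TraceEquiv loc w w' → w' = u ++ v ++ x → k ≤ v.length →
    locWord loc v = Finset.univ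

/-- Helper (on the reversed word) computing the view of a set of processes:
scanning from the right, keep an event iff its location meets the set of
processes already known to be causally after it. -/
def viewRev [DecidableEq P] (loc : α → Finset P) : Finset P → List α → List α
  | _, [] => []
  | T, a :: w =>
    if (loc a ∩ T).Nonempty then a :: viewRev loc (T ∪ loc a) w
    else viewRev loc T w

/-- The view of a set `X` of processes in the trace of `w`, as a linearisation. -/
def viewWord [DecidableEq P] (loc : α → Finset P) (X : Finset P) (w : List α) : List α :=
  (viewRev loc X w.reverse).reverse

theorem TE_length [DecidableEq P] (loc : α → Finset P) {w w' : List α}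
    (h : TraceEquiv loc w w') : w.length = w'.length := by
  induction h with
  | refl => rfl
  | tail _ h ih =>
    obtain ⟨u, v, a, b, _, rfl, rfl⟩ := h
    simpa using ih

theorem TE_ctx [DecidableEq P] (loc : α → Finset P) {w w' : List α} (x y : List α)
    (h : TraceEquiv loc w w') : TraceEquiv loc (x ++ w ++ y) (x ++ w' ++ y) := by
  induction h with
  | refl => exact Relation.ReflTransGen.refl
  | tail _ h ih =>
    refine Relation.ReflTransGen.tail ih ?_
    obtain ⟨u, v, a, b, hab, rfl, rfl⟩ := h
    exact ⟨x ++ u, v ++ y, a, b, hab, by simp, by simp⟩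

theorem TE_move [DecidableEq P] (loc : α → Finset P) (a : α) (R : List α)
    (h : ∀ b ∈ R, loc b ∩ loc a = ∅) : TraceEquiv loc (R ++ [a]) (a :: R) := by
  induction R with
  | nil => exact Relation.ReflTransGen.refl
  | cons b R ih =>
    have h1 := TE_ctx loc [b] [] (ih fun c hc => h c (List.mem_cons_of_mem _ hc))
    simp only [List.append_nil] at h1
    exact Relation.ReflTransGen.tail h1 ⟨[], R, b, a, h b (by simp), by simp, by simp⟩

theorem view_split [DecidableEq P] (loc : α → Finset P) (l : List α) :
    ∀ T : Finset P, ∃ R : List α, TraceEquiv loc l.reverse ((viewRev loc T l).reverse ++ R) ∧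
      ∀ a ∈ R, loc a ∩ T = ∅ := by
  induction l with
  | nil => exact fun T => ⟨[], Relation.ReflTransGen.refl, by simp⟩
  | cons a l ih =>
    intro T
    by_cases hT : (loc a ∩ T).Nonempty
    · obtain ⟨R, h1, h2⟩ := ih (T ∪ loc a)
      simp only [Finset.inter_union_distrib_left, Finset.union_eq_empty] at h2
      refine ⟨R, ?_, fun b hb => (h2 b hb).1⟩
      have h3 := TE_ctx loc [] [a] h1
      have h4 := TE_ctx loc (viewRev loc (T ∪ loc a) l).reverse []
        (TE_move loc a R fun b hb => (h2 b hb).2)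
      simp only [List.append_nil, List.nil_append, List.append_assoc] at h3 h4
      have h5 : TraceEquiv loc _ _ := Relation.ReflTransGen.trans h3 h4
      simpa [viewRev, hT] using h5
    · obtain ⟨R, h1, h2⟩ := ih T
      refine ⟨R ++ [a], ?_, ?_⟩
      · have h3 := TE_ctx loc [] [a] h1
        simpa [viewRev, hT] using h3
      · intro b hb
        rcases List.mem_append.1 hb with hb | hb
        · exact h2 b hb
        · rw [List.mem_singleton.1 hb]
          exact Finset.not_nonempty_iff_eq_empty.1 hT

theorem mem_locWord [DecidableEq P] (loc : α → Finset P) (p : P) (R : List α)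
    (h : p ∈ locWord loc R) : ∃ a ∈ R, p ∈ loc a := by
  induction R with
  | nil => simp [locWord] at h
  | cons b R ih =>
    have h' : p ∈ loc b ∪ locWord loc R := h
    rcases Finset.mem_union.1 h' with h' | h'
    · exact ⟨b, by simp, h'⟩
    · obtain ⟨a, ha, hp⟩ := ih h'
      exact ⟨a, by simp [ha], hp⟩

theorem view_bounds [DecidableEq P] [Fintype P] (loc : α → Finset P)
    (k : ℕ) (w : List α) (hfair : IsFairTrace loc k w) (p : P) :
    (viewWord loc {p} w).length ≤ w.length ∧ w.length < (viewWord loc {p} w).length + k := by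
  obtain ⟨R, h1, h2⟩ := view_split loc w.reverse {p}
  rw [List.reverse_reverse] at h1
  have hl := TE_length loc h1
  rw [List.length_append] at hl
  have hR : R.length < k := by
    by_contra hc
    have h3 := hfair _ (viewRev loc {p} w.reverse).reverse R [] h1 (by simp) (by omega)
    obtain ⟨a, ha, hp⟩ := mem_locWord loc p R (by rw [h3]; exact Finset.mem_univ p)
    have h4 : p ∈ loc a ∩ {p} := by simp [hp]
    rw [h2 a ha] at h4
    simp at h4
  unfold viewWord
  omega

/-- For a `k`-fair trace `t` and any processes `p, p'`,
the lengths of their views differ by at most `k - 1`. -/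
theorem abs_length_view_sub_le [DecidableEq P] [Fintype α] [Fintype P]
    (loc : α → Finset P) (hloc : ∀ a, (loc a).Nonempty)
    (k : ℕ) (hk : 1 ≤ k) (w : List α) (hfair : IsFairTrace loc k w) (p p' : P) :
    |((viewWord loc {p} w).length : ℤ) - ((viewWord loc {p'} w).length : ℤ)|
      ≤ (k : ℤ) - 1 := by
  have h1 := view_bounds loc k w hfair p
  have h2 := view_bounds loc k w hfair p'
  rw [abs_le]
  omega
end

section
/- Let A be a DFA over Σ with initial state q_0 satisfying the diamond property with respect to I, and let X ⊆ P. Let u_1, u_2, u_3 and v_1, v_2, v_3 be words such that: loc(u_2) ⊆ X, loc(v_2) ⊆ X, loc(u_3) ⊆ P∖X, loc(v_3) ⊆ P∖X; δ(q_0, u_1 u_2 u_3) and δ(q_0, v_1 v_2 v_3) are defined; δ(q_0, u_1) = δ(q_0, v_1); δ(q_0, u_1 u_2) = δ(q_0, v_1 v_2); and δ(q_0, u_1 u_3) = δ(q_0, v_1 v_3). Then δ(q_0, u_1 u_2 u_3) = δ(q_0, v_1 v_2 v_3). (Hence the state reached on u_1 u_2 u_3 depends only on the three intermediate states and X, defining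 a function diam.) -/
variable {α P : Type*}

/-- Deterministic finite-state automaton with partial transition function. -/
structure DetAut (α Q : Type*) where
  init : Q
  step : Q → α → Option Q
  final : Set Q

/-- Extended (partial) transition function on words. -/
def DetAut.run {Q : Type*} (A : DetAut α Q) (q : Q) (w : List α) : Option Q :=
  w.foldlM A.step q

/-- The word language accepted by the DFA. -/
def DetAut.lang {Q : Type*} (A : DetAut α Q) : Set (List α) :=
  {w | ∃ qf ∈ A.final, A.run A.init w = some qf}

/-- The diamond property of a DFA with respect to the independence relation. -/
def DetAut.Diamond {Q : Type*} [DecidableEq P] (loc : α → Finset P)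
    (A : DetAut α Q) : Prop :=
  ∀ a b q q' q'', loc a ∩ loc b = ∅ →
    A.step q a = some q' → A.step q' b = some q'' →
    ∃ q''', A.step q b = some q''' ∧ A.step q''' a = some q''

theorem DetAut.run_nil' {Q : Type*} (A : DetAut α Q) (q : Q) : A.run q [] = some q := rfl

theorem DetAut.run_cons' {Q : Type*} (A : DetAut α Q) (q : Q) (a : α) (w : List α) :
    A.run q (a :: w) = (A.step q a).bind (fun r => A.run r w) := rfl

theorem DetAut.run_append' {Q : Type*} (A : DetAut α Q) (q : Q) (u v : List α) :
    A.run q (u ++ v) = (A.run q u).bind (fun r => A.run r v) := by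
  induction u generalizing q with
  | nil => rfl
  | cons a u ih =>
    rw [List.cons_append, DetAut.run_cons', DetAut.run_cons', Option.bind_assoc]
    congr 1
    funext r
    exact ih r

theorem DetAut.step_comm' {Q : Type*} [DecidableEq P] (loc : α → Finset P)
    (A : DetAut α Q) (hd : A.Diamond loc) (a b : α) (hab : loc a ∩ loc b = ∅) (q : Q) :
    (A.step q a).bind (fun r => A.step r b) = (A.step q b).bind (fun r => A.step r a) := by
  apply Option.ext
  intro t
  simp only [Option.bind_eq_some_iff]
  constructor
  · rintro ⟨r, h, h'⟩
    exact hd a b q r t hab h h'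
  · rintro ⟨r, h, h'⟩
    exact hd b a q r t (by rw [Finset.inter_comm]; exact hab) h h'

theorem DetAut.step_run_comm' {Q : Type*} [DecidableEq P] (loc : α → Finset P)
    (A : DetAut α Q) (hd : A.Diamond loc) (a : α) (w : List α)
    (h : ∀ b ∈ w, loc a ∩ loc b = ∅) (q : Q) :
    (A.step q a).bind (fun r => A.run r w) = (A.run q w).bind (fun r => A.step r a) := by
  induction w generalizing q with
  | nil => simp [DetAut.run_nil']
  | cons b w ih =>
    have ih' := ih (fun c hc => h c (List.mem_cons_of_mem _ hc))
    simp only [DetAut.run_cons']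
    rw [← Option.bind_assoc, DetAut.step_comm' loc A hd a b (h b List.mem_cons_self),
      Option.bind_assoc, Option.bind_assoc]
    congr 1
    funext r
    exact ih' r

theorem DetAut.run_comm' {Q : Type*} [DecidableEq P] (loc : α → Finset P)
    (A : DetAut α Q) (hd : A.Diamond loc) (u w : List α)
    (h : ∀ a ∈ u, ∀ b ∈ w, loc a ∩ loc b = ∅) (q : Q) :
    A.run q (u ++ w) = A.run q (w ++ u) := by
  induction u generalizing q with
  | nil => simp
  | cons a u ih =>
    have ih' := ih (fun c hc => h c (List.mem_cons_of_mem _ hc))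
    rw [List.cons_append, DetAut.run_cons', DetAut.run_append' A q w (a :: u)]
    simp only [ih', DetAut.run_append', DetAut.run_cons']
    rw [← Option.bind_assoc, DetAut.step_run_comm' loc A hd a w (h a List.mem_cons_self),
      Option.bind_assoc]

theorem loc_subset_locWord' [DecidableEq P] (loc : α → Finset P) (w : List α) :
    ∀ a ∈ w, loc a ⊆ locWord loc w := by
  induction w with
  | nil => simp
  | cons b w ih =>
    intro a ha
    change loc a ⊆ loc b ∪ locWord loc w
    rcases List.mem_cons.1 ha with rfl | ha
    · exact Finset.subset_union_left
    · exact (ih a ha).trans Finset.subset_union_right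

/-- For a DFA satisfying the diamond property, the state
reached on `u₁u₂u₃` (with `loc u₂ ⊆ X` and `loc u₃ ⊆ P ∖ X`) only depends on the
three intermediate states and on `X`. -/
theorem diam_well_defined {Q : Type*} [DecidableEq P] [Fintype α] [Fintype P]
    (loc : α → Finset P) (hloc : ∀ a, (loc a).Nonempty)
    (A : DetAut α Q) (hdiam : A.Diamond loc) (X : Finset P)
    (u₁ u₂ u₃ v₁ v₂ v₃ : List α)
    (hu₂ : locWord loc u₂ ⊆ X) (hv₂ : locWord loc v₂ ⊆ X)
    (hu₃ : locWord loc u₃ ⊆ Xᶜ) (hv₃ : locWord loc v₃ ⊆ Xᶜ)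
    (hud : (A.run A.init (u₁ ++ u₂ ++ u₃)).isSome)
    (hvd : (A.run A.init (v₁ ++ v₂ ++ v₃)).isSome)
    (h₁ : A.run A.init u₁ = A.run A.init v₁)
    (h₂ : A.run A.init (u₁ ++ u₂) = A.run A.init (v₁ ++ v₂))
    (h₃ : A.run A.init (u₁ ++ u₃) = A.run A.init (v₁ ++ v₃)) :
    A.run A.init (u₁ ++ u₂ ++ u₃) = A.run A.init (v₁ ++ v₂ ++ v₃) := by
  have key : ∀ x y : List α, locWord loc x ⊆ X → locWord loc y ⊆ Xᶜ → ∀ q,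
      A.run q (x ++ y) = A.run q (y ++ x) := by
    intro x y hx hy q
    apply DetAut.run_comm' loc A hdiam
    intro a ha b hb
    have h1 := (loc_subset_locWord' loc x a ha).trans hx
    have h2 := (loc_subset_locWord' loc y b hb).trans hy
    exact Finset.disjoint_iff_inter_eq_empty.1
      (Finset.disjoint_of_subset_left h1
        (Finset.disjoint_of_subset_right h2 disjoint_compl_right))
  have key2 : ∀ z x y : List α, locWord loc x ⊆ X → locWord loc y ⊆ Xᶜ →
      A.run A.init (z ++ x ++ y) = A.run A.init (z ++ y ++ x) := by
    intro z x y hx hy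
    rw [List.append_assoc, List.append_assoc, DetAut.run_append', DetAut.run_append' A _ z]
    simp only [key x y hx hy]
  calc A.run A.init (u₁ ++ u₂ ++ u₃) = A.run A.init (v₁ ++ v₂ ++ u₃) := by
        rw [DetAut.run_append', h₂, ← DetAut.run_append']
    _ = A.run A.init (v₁ ++ u₃ ++ v₂) := key2 _ _ _ hv₂ hu₃
    _ = A.run A.init (u₁ ++ u₃ ++ v₂) := by
        rw [DetAut.run_append', DetAut.run_append' A _ v₁, ← h₁, ← DetAut.run_append',
          ← DetAut.run_append']
    _ = A.run A.init (v₁ ++ v₃ ++ v₂) := by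
        rw [DetAut.run_append', h₃, ← DetAut.run_append']
    _ = A.run A.init (v₁ ++ v₂ ++ v₃) := (key2 _ _ _ hv₂ hv₃).symm
end

section
/- Let A be a DFA over Σ satisfying the diamond property with respect to I_loc. Then there exists an asynchronous automaton B over (Σ, loc), whose local state sets Q_p may be infinite, such that L_t(B) = L_t(A). -/
variable {α P : Type*}

/-- Asynchronous automaton over a distributed alphabet `(α, loc)`: the
transition for letter `a` only reads and writes the components of processes
in `loc a`. -/
structure AsyncAut (α : Type*) {P : Type*} (loc : α → Finset P) (Q : P → Type*) where
  init : ∀ p, Q p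
  trans : α → (∀ p, Q p) → (∀ p, Q p)
  final : Set (∀ p, Q p)
  trans_untouched : ∀ a s p, p ∉ loc a → trans a s p = s p
  trans_local : ∀ a s s', (∀ p ∈ loc a, s p = s' p) →
    ∀ p ∈ loc a, trans a s p = trans a s' p

/-- The global state reached from the initial state when reading `w`
in the semantics of the asynchronous automaton. -/
def AsyncAut.run {loc : α → Finset P} {Q : P → Type*}
    (B : AsyncAut α loc Q) (w : List α) : ∀ p, Q p :=
  w.foldl (fun s a => B.trans a s) B.init

/-- The word language accepted by the asynchronous automaton. -/
def AsyncAut.lang {loc : α → Finset P} {Q : P → Type*}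
    (B : AsyncAut α loc Q) : Set (List α) :=
  {w | B.run w ∈ B.final}

/-- The set of traces of words of `L`, represented by all their linearisations;
two languages have the same set of traces iff their `traceClosure`s coincide. -/
def traceClosure [DecidableEq P] (loc : α → Finset P) (L : Set (List α)) :
    Set (List α) :=
  {w' | ∃ w ∈ L, TraceEquiv loc w w'}

theorem TraceEquiv.cons' [DecidableEq P] {loc : α → Finset P} {u v : List α} (c : α)
    (h : TraceEquiv loc u v) : TraceEquiv loc (c :: u) (c :: v) := by
  refine Relation.ReflTransGen.lift (c :: ·) ?_ _ _ h
  rintro x y ⟨l, r, a, b, hab, rfl, rfl⟩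
  exact ⟨c :: l, r, a, b, hab, by simp, by simp⟩

theorem traceEquiv_move [DecidableEq P] {loc : α → Finset P} (a : α) (x y : List α)
    (h : ∀ b ∈ x, loc a ∩ loc b = ∅) : TraceEquiv loc (a :: (x ++ y)) (x ++ a :: y) := by
  induction x with
  | nil => exact Relation.ReflTransGen.refl
  | cons b x ih =>
    have h1 := TraceEquiv.cons' b (ih (fun c hc => h c (List.mem_cons_of_mem _ hc)))
    exact Relation.ReflTransGen.head
      ⟨[], x ++ y, a, b, h b List.mem_cons_self, rfl, rfl⟩ h1

theorem traceEquiv_of_proj [DecidableEq P] {loc : α → Finset P}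
    (hloc : ∀ a, (loc a).Nonempty) (w : List α) : ∀ w' : List α,
    (∀ p, w.filter (fun a => decide (p ∈ loc a)) = w'.filter (fun a => decide (p ∈ loc a))) →
    TraceEquiv loc w w' := by
  classical
  induction w with
  | nil =>
    intro w' h
    cases w' with
    | nil => exact Relation.ReflTransGen.refl
    | cons b t =>
      obtain ⟨p, hp⟩ := hloc b
      have := h p
      simp [hp] at this
  | cons a u ih =>
    intro w' h
    have ha : a ∈ w' := by
      obtain ⟨p, hp⟩ := hloc a
      have h1 : a ∈ (a :: u).filter (fun a => decide (p ∈ loc a)) := by simp [hp]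
      rw [h p] at h1
      exact (List.mem_filter.1 h1).1
    obtain ⟨x, y, hx, rfl⟩ : ∃ x y, a ∉ x ∧ w' = x ++ a :: y := by
      obtain ⟨x, y, h1, h2⟩ := List.eq_append_cons_of_mem ha
      exact ⟨x, y, h2, h1⟩
    have key : ∀ p ∈ loc a, x.filter (fun a => decide (p ∈ loc a)) = [] := by
      intro p hp
      have h1 := h p
      rw [List.filter_append, List.filter_cons_of_pos (by simpa using hp)] at h1
      cases hf : x.filter (fun a => decide (p ∈ loc a)) with
      | nil => rfl
      | cons c t =>
        rw [hf, List.cons_append] at h1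
        have hc : c ∈ x.filter (fun a => decide (p ∈ loc a)) := by rw [hf]; simp
        exact absurd ((List.cons.inj h1).1 ▸ (List.mem_filter.1 hc).1) hx
    have hind : ∀ b ∈ x, loc a ∩ loc b = ∅ := by
      intro b hb
      rw [Finset.eq_empty_iff_forall_notMem]
      intro p hp
      rw [Finset.mem_inter] at hp
      have h1 : b ∈ x.filter (fun a => decide (p ∈ loc a)) := by simp [hb, hp.2]
      rw [key p hp.1] at h1
      simp at h1
    refine Relation.ReflTransGen.trans (TraceEquiv.cons' a (ih (x ++ y) ?_))
      (traceEquiv_move a x y hind)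
    intro p
    have h1 := h p
    by_cases hp : p ∈ loc a
    · rw [List.filter_append, key p hp]
      rw [List.filter_append, key p hp] at h1
      simpa [hp] using h1
    · simpa [hp] using h1

/-- Every DFA satisfying the diamond property (w.r.t. the
independence relation induced by `loc`) is trace-equivalent to some
asynchronous automaton, whose local state sets may be infinite. -/
theorem exists_asyncAut_of_diamond {QA : Type*} [DecidableEq P]
    [Fintype α] [Fintype P] [Fintype QA]
    (loc : α → Finset P) (hloc : ∀ a, (loc a).Nonempty)
    (A : DetAut α QA) (hdiam : A.Diamond loc) :
    ∃ (Q : P → Type) (B : AsyncAut α loc Q),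
      traceClosure loc B.lang = traceClosure loc A.lang := by
  classical
  let e := Fintype.equivFin α
  let C : AsyncAut α loc (fun _ : P => List (Fin (Fintype.card α))) :=
    { init := fun _ => []
      trans := fun a s p => if p ∈ loc a then s p ++ [e a] else s p
      final := ∅
      trans_untouched := by intro a s p hp; simp [hp]
      trans_local := by intro a s s' h p hp; simp [hp, h p hp] }
  let B : AsyncAut α loc (fun _ : P => List (Fin (Fintype.card α))) :=
    { C with final := {s | ∃ w ∈ A.lang, C.run w = s} }
  have hrun : ∀ w p, C.run w p = (w.filter (fun a => decide (p ∈ loc a))).map e := by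
    intro w p
    induction w using List.reverseRecOn with
    | nil => rfl
    | append_singleton w a ih =>
      have h1 : C.run (w ++ [a]) = C.trans a (C.run w) := by
        simp [AsyncAut.run, List.foldl_append]
      rw [h1]
      change (if p ∈ loc a then C.run w p ++ [e a] else C.run w p) = _
      rw [ih]
      by_cases hp : p ∈ loc a <;> simp [hp]
  have hB : ∀ w, w ∈ B.lang ↔ ∃ v ∈ A.lang, C.run v = C.run w := fun w => Iff.rfl
  refine ⟨_, B, ?_⟩
  ext w
  constructor
  · rintro ⟨v, hv, hvw⟩
    obtain ⟨u, hu, huv⟩ := (hB v).1 hv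
    refine ⟨u, hu, Relation.ReflTransGen.trans (traceEquiv_of_proj hloc u v ?_) hvw⟩
    intro p
    have h1 := congrFun huv p
    rw [hrun, hrun] at h1
    exact List.map_injective_iff.2 e.injective h1
  · rintro ⟨v, hv, hvw⟩
    exact ⟨v, (hB v).2 ⟨v, hv, rfl⟩, hvw⟩
end
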